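/- Let $p(\cdot):\mathbb{R}^n\to[1,\infty)$ be an exponent function such that the Hardy–Littlewood maximal operator is bounded on the variable Lebesgue space $L^{p(\cdot)}$. Then for every cube $Q$, $\|\chi_Q\|_{L^{p(\cdot)}}\approx|Q|^{1/p_Q}$ and $\|\chi_Q\|_{L^{p'(\cdot)}}\approx|Q|^{1/p'_Q}$, with implicit constants independent of $Q$, where $1/p_Q=\fint_Q 1/p(x)\,dx$ and $1/p'_Q=\fint_Q 1/p'(x)\,dx$; consequently $\|\chi_Q\|_{L^{p(\cdot)}}\|\chi_Q\|_{L^{p'(\cdot)}}\le C|Q|$. -/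

import Mathlib

open MeasureTheory ENNReal

noncomputable section

def cube (n : ℕ) (c : Fin n → ℝ) (r : ℝ) : Set (Fin n → ℝ) :=
  {x | ∀ i, |x i - c i| ≤ r / 2}

def eavg {n : ℕ} (Q : Set (Fin n → ℝ)) (f : (Fin n → ℝ) → ℝ≥0∞) : ℝ≥0∞ :=
  (∫⁻ x in Q, f x) / volume Q

/-- Luxemburg norm of the variable Lebesgue space `L^{p(·)}`. -/
def vnorm {n : ℕ} (p : (Fin n → ℝ) → ℝ) (f : (Fin n → ℝ) → ℝ≥0∞) : ℝ≥0∞ :=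
  sInf {lam : ℝ≥0∞ | 0 < lam ∧ ∫⁻ x, (f x / lam) ^ p x ≤ 1}

/-- The Hardy–Littlewood maximal operator. -/
def maximal (n : ℕ) (f : (Fin n → ℝ) → ℝ≥0∞) (x : Fin n → ℝ) : ℝ≥0∞ :=
  ⨆ (c : Fin n → ℝ) (r : ℝ) (_ : 0 < r) (_ : x ∈ cube n c r), eavg (cube n c r) f

lemma cube_eq (n : ℕ) (c : Fin n → ℝ) (r : ℝ) (hr : 0 < r) :
    cube n c r = Metric.closedBall c (r / 2) := by
  ext x
  rw [Metric.mem_closedBall, dist_pi_le_iff (by positivity)]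
  simp [cube, Real.dist_eq]

lemma le_maximal {n : ℕ} (f : (Fin n → ℝ) → ℝ≥0∞) {c : Fin n → ℝ} {r : ℝ} (hr : 0 < r)
    {x : Fin n → ℝ} (hx : x ∈ cube n c r) : eavg (cube n c r) f ≤ maximal n f x := by
  unfold maximal
  exact le_iSup_of_le c (le_iSup_of_le r (le_iSup_of_le hr (le_iSup_of_le hx le_rfl)))

lemma modular_maximal {n : ℕ} {p : (Fin n → ℝ) → ℝ} (hp : ∀ x, 1 ≤ p x)
    {B : ℝ≥0∞} (hB : B ≠ ⊤)
    (hbdd : ∀ f, vnorm p (maximal n f) ≤ B * vnorm p f) (f : (Fin n → ℝ) → ℝ≥0∞)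
    (hf : ∫⁻ x, f x ^ p x ≤ 1) :
    ∫⁻ x, (maximal n f x / (B + 1)) ^ p x ≤ 1 := by
  have h1 : vnorm p f ≤ 1 := by
    apply sInf_le
    refine ⟨by simp, ?_⟩
    simpa using hf
  have h2 : vnorm p (maximal n f) < B + 1 := by
    calc _ ≤ B * vnorm p f := hbdd f
      _ ≤ B * 1 := by gcongr
      _ = B := by simp
      _ < B + 1 := ENNReal.lt_add_right hB (by simp)
  unfold vnorm at h2
  rw [sInf_lt_iff] at h2
  obtain ⟨l, ⟨hl0, hl⟩, hlB⟩ := h2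
  refine le_trans (lintegral_mono fun x => ?_) hl
  have := hp x
  exact ENNReal.rpow_le_rpow (ENNReal.div_le_div_left hlB.le _) (by linarith)

lemma vnorm_upper {n : ℕ} {p : (Fin n → ℝ) → ℝ} (hp : ∀ x, 1 ≤ p x)
    {B : ℝ≥0∞} (hB : B ≠ ⊤)
    (hbdd : ∀ f, vnorm p (maximal n f) ≤ B * vnorm p f) (f : (Fin n → ℝ) → ℝ≥0∞)
    (hf : ∫⁻ x, f x ^ p x ≤ 1) (c : Fin n → ℝ) (r : ℝ) (hr : 0 < r)
    (a : ℝ≥0∞) (ha0 : a ≠ 0) (hat : a ≠ ⊤) (ha : a ≤ eavg (cube n c r) f) :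
    vnorm p ((cube n c r).indicator 1) ≤ (B + 1) / a := by
  apply sInf_le
  refine ⟨ENNReal.div_pos (by simp) hat, ?_⟩
  refine le_trans (lintegral_mono fun x => ?_) (modular_maximal hp hB hbdd f hf)
  have := hp x
  refine ENNReal.rpow_le_rpow ?_ (by linarith)
  by_cases hx : x ∈ cube n c r
  · simp only [Set.indicator_of_mem hx, Pi.one_apply]
    rw [one_div, ENNReal.inv_div (Or.inl hat) (Or.inl ha0)]
    exact ENNReal.div_le_div_right (ha.trans (le_maximal f hr hx)) _
  · simp [Set.indicator_of_notMem hx]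

lemma jensen {n : ℕ} (Q : Set (Fin n → ℝ)) (h0 : volume Q ≠ 0)
    (ht : volume Q ≠ ⊤) (g : (Fin n → ℝ) → ℝ) (hg : Measurable g) (hb : ∀ x, |g x| ≤ 1) :
    volume Q * volume Q ^ (⨍ x in Q, g x) ≤ ∫⁻ x in Q, volume Q ^ g x := by
  set v := (volume Q).toReal with hv
  have hvpos : 0 < v := ENNReal.toReal_pos h0 ht
  have hV : volume Q = ENNReal.ofReal v := (ENNReal.ofReal_toReal ht).symm
  have : IsFiniteMeasure (volume.restrict Q) := ⟨by simpa using ht.lt_top⟩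
  have hint : Integrable g (volume.restrict Q) :=
    Integrable.of_bound hg.aestronglyMeasurable 1 (Filter.Eventually.of_forall fun x => by simpa using hb x)
  set m := ⨍ x in Q, g x with hm
  have hm' : ∫ x in Q, g x = v * m := by
    rw [hm, setAverage_eq]
    simp [Measure.real, ← hv]
    field_simp
  have hpt : ∀ x, v ^ m * (1 + Real.log v * (g x - m)) ≤ v ^ g x := by
    intro x
    have h1 := Real.add_one_le_exp (Real.log v * (g x - m))
    have h2 : v ^ g x = v ^ m * Real.exp (Real.log v * (g x - m)) := by
      rw [Real.rpow_def_of_pos hvpos, Real.rpow_def_of_pos hvpos, ← Real.exp_add]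
      ring_nf
    rw [h2]
    have := Real.rpow_pos_of_pos hvpos m
    gcongr
    linarith
  have hE : ∀ t : ℝ, volume Q ^ t = ENNReal.ofReal (v ^ t) := fun t => by
    rw [hV, ENNReal.ofReal_rpow_of_pos hvpos]
  have hmeas : Measurable fun x => v ^ g x := by fun_prop
  simp_rw [hE]
  have hI2 : Integrable (fun x => v ^ m * (1 + Real.log v * (g x - m))) (volume.restrict Q) := by
    fun_prop
  have hI3 : Integrable (fun x => v ^ g x) (volume.restrict Q) := by
    refine Integrable.of_bound hmeas.aestronglyMeasurable (Real.exp |Real.log v|)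
      (Filter.Eventually.of_forall fun x => ?_)
    rw [Real.norm_of_nonneg (by positivity), Real.rpow_def_of_pos hvpos]
    apply Real.exp_le_exp.2
    calc _ ≤ |Real.log v * g x| := le_abs_self _
      _ = |Real.log v| * |g x| := abs_mul _ _
      _ ≤ |Real.log v| * 1 := by gcongr; exact hb x
      _ = _ := by simp
  rw [← ofReal_integral_eq_lintegral_ofReal hI3 (Filter.Eventually.of_forall fun x => by positivity)]
  rw [hV, ← ENNReal.ofReal_mul hvpos.le]
  apply ENNReal.ofReal_le_ofReal
  calc v * v ^ m = ∫ x in Q, v ^ m * (1 + Real.log v * (g x - m)) := by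
        rw [integral_const_mul, integral_add (by fun_prop) (by fun_prop), integral_const_mul,
          integral_sub hint (by fun_prop), hm']
        simp [Measure.real, ← hv]
        ring
    _ ≤ _ := integral_mono hI2 hI3 hpt

lemma vnorm_lower {n : ℕ} (u w : (Fin n → ℝ) → ℝ) (hu : Measurable u)
    (hub : ∀ x, |1 / u x - 1| ≤ 1)
    (huw : ∀ᵐ x, (u x).HolderConjugate (w x))
    (Q : Set (Fin n → ℝ)) (hQ : MeasurableSet Q) (h0 : volume Q ≠ 0)
    (ht : volume Q ≠ ⊤) (hint : IntegrableOn (fun x => 1 / u x) Q) :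
    2⁻¹ * volume Q ^ (⨍ x in Q, 1 / u x) ≤ vnorm u (Q.indicator 1) := by
  apply le_sInf
  rintro l ⟨hl0, hl⟩
  by_cases hlt : l = ⊤
  · simp [hlt]
  have hJ := jensen Q h0 ht (fun x => 1 / u x - 1) (by fun_prop) hub
  have hav : ⨍ x in Q, (1 / u x - 1) = (⨍ x in Q, 1 / u x) - 1 := by
    have : IsFiniteMeasure (volume.restrict Q) := ⟨by simpa using ht.lt_top⟩
    rw [setAverage_eq, setAverage_eq, integral_sub hint (by fun_prop)]
    have : volume.real Q ≠ 0 := (ENNReal.toReal_pos h0 ht).ne'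
    simp
    field_simp
  rw [hav] at hJ
  have e1 : volume Q * volume Q ^ ((⨍ x in Q, 1 / u x) - 1) = volume Q ^ (⨍ x in Q, 1 / u x) := by
    nth_rewrite 1 [← ENNReal.rpow_one (volume Q)]
    rw [← ENNReal.rpow_add _ _ h0 ht]
    congr 1; ring
  rw [e1] at hJ
  have hl' : ∫⁻ x in Q, (l⁻¹) ^ u x ≤ 1 := by
    refine le_trans ?_ hl
    rw [← lintegral_indicator hQ]
    refine lintegral_mono fun x => ?_
    by_cases hx : x ∈ Q
    · simp [hx]
    · simp [hx]
  have hY : ∫⁻ x in Q, l⁻¹ * volume Q ^ (1 / u x - 1) ≤ 2 := by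
    calc _ ≤ ∫⁻ x in Q, ((l⁻¹) ^ u x + (volume Q)⁻¹) := by
          apply lintegral_mono_ae
          filter_upwards [ae_restrict_of_ae huw] with x hx
          refine (ENNReal.young_inequality _ _ hx).trans ?_
          have hu1 : 1 ≤ ENNReal.ofReal (u x) := by
            simpa using ENNReal.ofReal_le_ofReal hx.lt.le
          have hw1 : 1 ≤ ENNReal.ofReal (w x) := by
            simpa using ENNReal.ofReal_le_ofReal hx.symm.lt.le
          have e2 : (volume Q ^ (1 / u x - 1)) ^ w x = (volume Q)⁻¹ := by
            rw [← ENNReal.rpow_mul, ← ENNReal.rpow_neg_one]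
            congr 1
            have := hx.one_sub_inv
            have h3 := hx.symm.ne_zero
            rw [one_div, show (u x)⁻¹ - 1 = -(w x)⁻¹ by linarith]
            field_simp
          rw [e2]
          gcongr
          · exact ENNReal.div_le_of_le_mul (le_mul_of_one_le_right' hu1)
          · exact ENNReal.div_le_of_le_mul (le_mul_of_one_le_right' hw1)
      _ = (∫⁻ x in Q, (l⁻¹) ^ u x) + 1 := by
          rw [lintegral_add_right _ (by fun_prop)]
          simp [ENNReal.inv_mul_cancel h0 ht]
      _ ≤ 1 + 1 := by gcongr
      _ = 2 := by norm_num
  rw [lintegral_const_mul' _ _ (by simpa using hl0.ne')] at hY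
  have hfin : l⁻¹ * volume Q ^ (⨍ x in Q, 1 / u x) ≤ 2 := le_trans (by gcongr) hY
  rw [mul_comm, ← div_eq_mul_inv, ENNReal.div_le_iff hl0.ne' hlt] at hfin
  calc _ ≤ 2⁻¹ * (2 * l) := by gcongr
    _ = l := by rw [← mul_assoc, ENNReal.inv_mul_cancel (by simp) (by simp), one_mul]

lemma dual_upper {n : ℕ} {p : (Fin n → ℝ) → ℝ} (hp : ∀ x, 1 ≤ p x) (hpm : Measurable p)
    (hp1 : ∀ᵐ x, 1 < p x)
    {B : ℝ≥0∞} (hB : B ≠ ⊤)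
    (hbdd : ∀ f, vnorm p (maximal n f) ≤ B * vnorm p f)
    (c : Fin n → ℝ) (r : ℝ) (hr : 0 < r) (hQ : MeasurableSet (cube n c r))
    (h0 : volume (cube n c r) ≠ 0) (ht : volume (cube n c r) ≠ ⊤)
    (K : ℝ≥0∞) (hK0 : K ≠ 0) (hKt : K ≠ ⊤)
    (hK : 1 < ∫⁻ x, ((cube n c r).indicator 1 x / K) ^ (p x / (p x - 1))) :
    vnorm p ((cube n c r).indicator 1) ≤ (B + 1) / (K / volume (cube n c r)) := by
  set Q := cube n c r with hQdef
  set h : (Fin n → ℝ) → ℝ≥0∞ := fun x => K⁻¹ ^ (p x / (p x - 1)) with hh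
  have hKi0 : K⁻¹ ≠ 0 := by simpa using hKt
  have hKit : K⁻¹ ≠ ⊤ := by simpa using hK0
  have hhm : Measurable h := by fun_prop
  have hhfin : ∀ x, h x ≠ ⊤ := fun x => ENNReal.rpow_ne_top_of_ne_zero hKi0 hKit
  have hK2 : 1 < ∫⁻ x in Q, h x := by
    refine lt_of_lt_of_eq hK ?_
    rw [← lintegral_indicator hQ]
    apply lintegral_congr_ae
    filter_upwards [hp1] with x hx
    have : 0 < p x / (p x - 1) := div_pos (by linarith) (by linarith)
    by_cases hxQ : x ∈ Q
    · simp [hxQ, hh]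
    · simp [hxQ, this]
  set E : ℕ → Set (Fin n → ℝ) := fun N => Q ∩ {x | h x ≤ N} with hE
  have hEm : ∀ N, MeasurableSet (E N) := fun N => hQ.inter (measurableSet_le hhm measurable_const)
  have hU : ⋃ N, E N = Q := by
    apply Set.Subset.antisymm
    · exact Set.iUnion_subset fun N => Set.inter_subset_left
    · intro x hx
      obtain ⟨N, hN⟩ := ENNReal.exists_nat_gt (hhfin x)
      exact Set.mem_iUnion.2 ⟨N, hx, hN.le⟩
  have hmono : Monotone E := by
    intro a b hab x hx
    have hab' : (a : ℝ≥0∞) ≤ b := by exact_mod_cast hab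
    have hxa : h x ≤ a := hx.2
    exact ⟨hx.1, hxa.trans hab'⟩
  rw [← hU, setLIntegral_iUnion_of_directed _ hmono.directed_le, lt_iSup_iff] at hK2
  obtain ⟨N, hN⟩ := hK2
  set I := ∫⁻ x in E N, h x with hI
  have hI0 : I ≠ 0 := (lt_trans zero_lt_one hN).ne'
  have hIt : I ≠ ⊤ := by
    apply ne_of_lt
    calc I ≤ ∫⁻ x in E N, (N : ℝ≥0∞) := setLIntegral_mono measurable_const fun x hx => hx.2
      _ = N * volume (E N) := by simp
      _ ≤ N * volume Q := by gcongr; exact Set.inter_subset_left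
      _ < ⊤ := ENNReal.mul_lt_top (by simp) ht.lt_top
  refine vnorm_upper hp hB hbdd ((E N).indicator fun x => (h x / I) ^ (1 / p x)) ?_ c r hr _
    (ENNReal.div_pos hK0 ht).ne' (ENNReal.div_ne_top hKt h0) ?_
  · calc _ = ∫⁻ x in E N, h x * I⁻¹ := by
          rw [← lintegral_indicator (hEm N)]
          refine lintegral_congr fun x => ?_
          have := hp x
          by_cases hx : x ∈ E N
          · simp only [Set.indicator_of_mem hx]
            rw [← ENNReal.rpow_mul, one_div_mul_cancel (by linarith), ENNReal.rpow_one,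
              div_eq_mul_inv]
          · simp only [Set.indicator_of_notMem hx]
            exact ENNReal.zero_rpow_of_pos (by linarith)
      _ = I * I⁻¹ := by rw [lintegral_mul_const _ hhm]
      _ ≤ 1 := by rw [ENNReal.mul_inv_cancel hI0 hIt]
  · unfold eavg
    apply ENNReal.div_le_div_right
    calc K = (K * I⁻¹) * I := by rw [mul_assoc, ENNReal.inv_mul_cancel hI0 hIt, mul_one]
      _ = ∫⁻ x in E N, (K * I⁻¹) * h x := by rw [lintegral_const_mul _ hhm]
      _ ≤ ∫⁻ x in E N, (h x / I) ^ (1 / p x) := by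
          apply lintegral_mono_ae
          filter_upwards [ae_restrict_of_ae hp1] with x hx
          rw [ENNReal.div_rpow_of_nonneg _ _ (by positivity), div_eq_mul_inv]
          have e1 : h x ^ (1 / p x) = K * h x := by
            have e2 : K = K⁻¹ ^ (-1 : ℝ) := by rw [ENNReal.rpow_neg_one, inv_inv]
            calc _ = K⁻¹ ^ (-1 : ℝ) * h x := ?_
              _ = _ := by rw [← e2]
            simp only [hh]
            rw [← ENNReal.rpow_mul, ← ENNReal.rpow_add _ _ hKi0 hKit]
            congr 1
            have : p x - 1 ≠ 0 := by linarith
            have : p x ≠ 0 := by linarith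
            field_simp
            ring
          rw [e1, mul_right_comm]
          gcongr
          have h1p : 1 / p x ≤ 1 := by rw [div_le_one (by linarith)]; exact hx.le
          calc I ^ (1 / p x) ≤ I ^ (1 : ℝ) := ENNReal.rpow_le_rpow_of_exponent_le hN.le h1p
            _ = I := by simp
      _ = ∫⁻ x in Q, (E N).indicator (fun x => (h x / I) ^ (1 / p x)) x := by
          rw [setLIntegral_indicator (hEm N)]
          congr 2
          rw [Set.inter_eq_left.2]
          exact Set.inter_subset_left

lemma ae_one_lt {n : ℕ} (hn : 0 < n) {p : (Fin n → ℝ) → ℝ} (hp : ∀ x, 1 ≤ p x)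
    (hpm : Measurable p) {B : ℝ≥0∞} (hB : B ≠ ⊤)
    (hbdd : ∀ f, vnorm p (maximal n f) ≤ B * vnorm p f) : ∀ᵐ x, 1 < p x := by
  set E : Set (Fin n → ℝ) := {x | p x = 1} with hE
  have hEm : MeasurableSet E := hpm (measurableSet_singleton 1)
  suffices hE0 : volume E = 0 by
    rw [ae_iff]
    refine measure_mono_null (fun x hx => ?_) hE0
    have := hp x
    simp only [Set.mem_ofPred_eq, not_lt] at hx
    exact le_antisymm hx this
  by_contra hE0
  have hne : (ae (volume.restrict E)).NeBot := by
    rw [ae_neBot]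
    simpa using hE0
  obtain ⟨x₀, hx₀⟩ := (Besicovitch.ae_tendsto_measure_inter_div (volume : Measure (Fin n → ℝ)) E).exists
  have h34 : (3 / 4 : ℝ≥0∞) < 1 := by
    rw [ENNReal.div_lt_iff (by simp) (by simp)]; norm_num
  have hev := hx₀.eventually (lt_mem_nhds h34)
  rw [eventually_nhdsWithin_iff, Metric.eventually_nhds_iff] at hev
  obtain ⟨δ, hδ, hev⟩ := hev
  obtain ⟨N, hN⟩ := ENNReal.exists_nat_gt (show 4 * (B + 1) ≠ ⊤ by finiteness)
  set ρ : ℕ → ℝ := fun k => δ / 2 * 2 ^ k / 2 ^ N with hρ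
  have hρ0 : ∀ k, 0 < ρ k := fun k => by positivity
  have hρs : ∀ k, ρ (k + 1) = 2 * ρ k := fun k => by simp only [hρ]; ring
  have hρm : Monotone ρ := monotone_nat_of_le_succ fun k => by rw [hρs]; linarith [hρ0 k]
  have hρN : ∀ k ≤ N, ρ k < δ := fun k hk => by
    refine (hρm hk).trans_lt ?_
    simp only [hρ]
    rw [mul_div_assoc, div_self (by positivity)]
    linarith
  set b : ℕ → Set (Fin n → ℝ) := fun k => Metric.closedBall x₀ (ρ k) with hb
  have hbm : ∀ k, MeasurableSet (b k) := fun k => measurableSet_closedBall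
  have hbmono : Monotone b := fun i j hij => Metric.closedBall_subset_closedBall (hρm hij)
  have hbpos : ∀ k, volume (b k) ≠ 0 := fun k => (Metric.measure_closedBall_pos _ _ (hρ0 k)).ne'
  have hbfin : ∀ k, volume (b k) ≠ ⊤ := fun k => measure_closedBall_lt_top.ne
  have hbs : ∀ k, 2 * volume (b k) ≤ volume (b (k + 1)) := fun k => by
    simp only [hb]
    rw [Real.volume_pi_closedBall _ (hρ0 _).le, Real.volume_pi_closedBall _ (hρ0 _).le, hρs,
      show (2 : ℝ≥0∞) = ENNReal.ofReal 2 by simp, ← ENNReal.ofReal_mul (by norm_num)]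
    apply ENNReal.ofReal_le_ofReal
    rw [mul_pow 2 (2 * ρ k)]
    have := hρ0 k
    gcongr
    exact le_self_pow₀ (by norm_num) (by simpa using hn.ne')
  have hden : ∀ k ≤ N, 3 / 4 * volume (b k) < volume (E ∩ b k) := fun k hk => by
    have := hev (y := ρ k) (by simpa [abs_of_pos (hρ0 k)] using hρN k hk) (hρ0 k)
    rwa [ENNReal.lt_div_iff_mul_lt (Or.inl (hbpos k)) (Or.inl (hbfin k))] at this
  set F := E ∩ b 0 with hF
  have hFm : MeasurableSet F := hEm.inter (hbm 0)
  have hF0 : volume F ≠ 0 := (lt_of_le_of_lt bot_le (hden 0 (Nat.zero_le _))).ne'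
  have hFt : volume F ≠ ⊤ := measure_ne_top_of_subset Set.inter_subset_right (hbfin 0)
  set f : (Fin n → ℝ) → ℝ≥0∞ := F.indicator fun _ => (volume F)⁻¹ with hf
  have hfp : ∫⁻ x, f x ^ p x ≤ 1 := by
    calc _ = ∫⁻ x in F, (volume F)⁻¹ := by
          rw [← lintegral_indicator hFm]
          refine lintegral_congr fun x => ?_
          by_cases hx : x ∈ F
          · have : p x = 1 := hx.1
            simp [hf, hx, this]
          · have := hp x
            simp only [hf, Set.indicator_of_notMem hx]
            exact ENNReal.zero_rpow_of_pos (by linarith)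
      _ ≤ 1 := by simp [ENNReal.inv_mul_cancel hF0 hFt]
  have hM := modular_maximal hp hB hbdd f hfp
  have hMb : ∀ k, ∀ x ∈ b k, (volume (b k))⁻¹ ≤ maximal n f x := by
    intro k x hx
    have hc : cube n x₀ (2 * ρ k) = b k := by
      rw [cube_eq _ _ _ (by linarith [hρ0 k])]; simp [hb]
    have hx' : x ∈ cube n x₀ (2 * ρ k) := by rw [hc]; exact hx
    refine le_trans (le_of_eq ?_) (le_maximal f (by linarith [hρ0 k]) hx')
    unfold eavg
    rw [hc, hf, setLIntegral_indicator hFm, Set.inter_eq_left.2]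
    · simp [ENNReal.inv_mul_cancel hF0 hFt]
    · exact Set.inter_subset_right.trans (hbmono (Nat.zero_le k))
  have hind : ∀ k ≤ N, (k : ℝ≥0∞) / 4 ≤ ∫⁻ x in E ∩ b k, maximal n f x := by
    intro k
    induction k with
    | zero => intro _; simp
    | succ k ih =>
      intro hk
      have ih' := ih (by omega)
      set A := E ∩ (b (k + 1) \ b k) with hA
      have hAm : MeasurableSet A := hEm.inter ((hbm _).diff (hbm _))
      have hun : E ∩ b (k + 1) = (E ∩ b k) ∪ A := by
        ext x
        have := @hbmono k (k + 1) (by omega) x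
        simp only [hA, Set.mem_inter_iff, Set.mem_union, Set.mem_sdiff]
        tauto
      have hdis : Disjoint (E ∩ b k) A := by
        rw [Set.disjoint_left]
        intro x hx hx2
        exact hx2.2.2 hx.2
      have hAvol : 1 / 4 * volume (b (k + 1)) ≤ volume A := by
        have h1 := (hden (k + 1) hk).le
        rw [hun] at h1
        have h2 : 3 / 4 * volume (b (k + 1)) ≤ volume (b k) + volume A :=
          h1.trans ((measure_union_le _ _).trans (by gcongr; exact Set.inter_subset_right))
        have h3 := hbs k
        have hAt : volume A ≠ ⊤ := measure_ne_top_of_subset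
          (Set.inter_subset_right.trans Set.sdiff_subset) (hbfin (k + 1))
        have f1 := hbfin k
        have f2 := hbfin (k + 1)
        generalize volume (b (k + 1)) = v1 at *
        generalize volume (b k) = v0 at *
        generalize volume A = v2 at *
        lift v1 to NNReal using f2
        lift v0 to NNReal using f1
        lift v2 to NNReal using hAt
        have e34 : (3 / 4 : ℝ≥0∞) = ((3 / 4 : NNReal) : ℝ≥0∞) := by
          rw [ENNReal.coe_div (by norm_num)]; rfl
        have e14 : (1 / 4 : ℝ≥0∞) = ((1 / 4 : NNReal) : ℝ≥0∞) := by
          rw [ENNReal.coe_div (by norm_num)]; rfl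
        rw [e34] at h2
        rw [e14]
        norm_cast at h2 h3 ⊢
        rw [← NNReal.coe_le_coe] at h2 h3 ⊢
        push_cast at h2 h3 ⊢
        linarith
      rw [hun, lintegral_union hAm hdis]
      push_cast
      rw [ENNReal.add_div]
      gcongr
      calc (1 / 4 : ℝ≥0∞) = (volume (b (k + 1)))⁻¹ * (1 / 4 * volume (b (k + 1))) := by
            rw [mul_comm (1 / 4), ← mul_assoc, ENNReal.inv_mul_cancel (hbpos _) (hbfin _), one_mul]
        _ ≤ (volume (b (k + 1)))⁻¹ * volume A := by gcongr
        _ = ∫⁻ x in A, (volume (b (k + 1)))⁻¹ := by simp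
        _ ≤ _ := setLIntegral_mono' hAm fun x hx => hMb _ x hx.2.1
  have hlast : (B + 1)⁻¹ * ∫⁻ x in E ∩ b N, maximal n f x ≤ 1 := by
    rw [← lintegral_const_mul' _ _ (by simp)]
    refine le_trans ?_ hM
    rw [← lintegral_indicator (hEm.inter (hbm N))]
    refine lintegral_mono fun x => ?_
    by_cases hx : x ∈ E ∩ b N
    · have : p x = 1 := hx.1
      simp only [Set.indicator_of_mem hx, this, ENNReal.rpow_one]
      rw [mul_comm, div_eq_mul_inv]
    · simp [hx]
  rw [mul_comm, ← div_eq_mul_inv, ENNReal.div_le_iff (by simp) (by finiteness), one_mul] at hlast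
  have h5 := (hind N le_rfl).trans hlast
  rw [ENNReal.div_le_iff (by simp) (by simp), mul_comm] at h5
  exact absurd hN (not_lt.2 h5)

theorem variable_chiQ_norms (n : ℕ) (hn : 0 < n)
    (p : (Fin n → ℝ) → ℝ) (hp : ∀ x, 1 ≤ p x) (hpm : Measurable p)
    (B : ℝ≥0∞) (hB : B ≠ ⊤)
    (hbdd : ∀ f, vnorm p (maximal n f) ≤ B * vnorm p f) :
    ∃ c₁ c₂ c₃ c₄ C : ℝ≥0∞, 0 < c₁ ∧ c₂ ≠ ⊤ ∧ 0 < c₃ ∧ c₄ ≠ ⊤ ∧ C ≠ ⊤ ∧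
      ∀ c r, 0 < r →
        (c₁ * volume (cube n c r) ^ (⨍ x in cube n c r, 1 / p x) ≤
            vnorm p ((cube n c r).indicator 1) ∧
          vnorm p ((cube n c r).indicator 1) ≤
            c₂ * volume (cube n c r) ^ (⨍ x in cube n c r, 1 / p x)) ∧
        (c₃ * volume (cube n c r) ^ (1 - ⨍ x in cube n c r, 1 / p x) ≤
            vnorm (fun x => p x / (p x - 1)) ((cube n c r).indicator 1) ∧
          vnorm (fun x => p x / (p x - 1)) ((cube n c r).indicator 1) ≤
            c₄ * volume (cube n c r) ^ (1 - ⨍ x in cube n c r, 1 / p x)) ∧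
        vnorm p ((cube n c r).indicator 1) *
            vnorm (fun x => p x / (p x - 1)) ((cube n c r).indicator 1) ≤
          C * volume (cube n c r) := by
  have hp1 := ae_one_lt hn hp hpm hB hbdd
  refine ⟨2⁻¹, B + 1, 2⁻¹, 4 * (B + 1), (B + 1) * (4 * (B + 1)), by simp, by finiteness, by simp,
    by finiteness, by finiteness, ?_⟩
  intro c r hr
  have hcube := cube_eq n c r hr
  have hQ : MeasurableSet (cube n c r) := by rw [hcube]; exact measurableSet_closedBall
  have h0 : volume (cube n c r) ≠ 0 := by
    rw [hcube]; exact (Metric.measure_closedBall_pos _ _ (by positivity)).ne'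
  have ht : volume (cube n c r) ≠ ⊤ := by rw [hcube]; exact measure_closedBall_lt_top.ne
  have hfinm : IsFiniteMeasure (volume.restrict (cube n c r)) := ⟨by simpa using ht.lt_top⟩
  have hb0 : ∀ x, 0 ≤ 1 / p x := fun x => by have := hp x; positivity
  have hb1 : ∀ x, 1 / p x ≤ 1 := fun x => by
    have := hp x
    rw [div_le_one (by linarith)]; exact this
  have hint : IntegrableOn (fun x => 1 / p x) (cube n c r) :=
    Integrable.of_bound (Measurable.aestronglyMeasurable (by fun_prop)) 1 (Filter.Eventually.of_forall fun x => by
      rw [Real.norm_of_nonneg (hb0 x)]; exact hb1 x)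
  have hdual : ∀ x, 1 / (p x / (p x - 1)) = 1 - 1 / p x := fun x => by
    have := hp x
    have : p x ≠ 0 := by linarith
    rw [one_div_div]
    field_simp
  have hconj : ∀ᵐ x, (p x).HolderConjugate (p x / (p x - 1)) := by
    filter_upwards [hp1] with x hx
    exact Real.HolderConjugate.conjExponent hx
  have hav : ⨍ x in cube n c r, 1 / (p x / (p x - 1)) = 1 - ⨍ x in cube n c r, 1 / p x := by
    simp_rw [hdual]
    rw [setAverage_eq, setAverage_eq, integral_sub (by fun_prop) hint]
    have : volume.real (cube n c r) ≠ 0 := (ENNReal.toReal_pos h0 ht).ne'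
    simp
    field_simp
  have hL1 := vnorm_lower p (fun x => p x / (p x - 1)) hpm
    (fun x => by rw [abs_le]; constructor <;> linarith [hb0 x, hb1 x]) hconj
    (cube n c r) hQ h0 ht hint
  have hL2 := vnorm_lower (fun x => p x / (p x - 1)) p (by fun_prop)
    (fun x => by rw [hdual, abs_le]; constructor <;> linarith [hb0 x, hb1 x])
    (hconj.mono fun x hx => hx.symm)
    (cube n c r) hQ h0 ht (by simp_rw [hdual]; exact (integrable_const _).sub hint)
  rw [hav] at hL2
  set m := ⨍ x in cube n c r, 1 / p x with hm
  have hpow0 : ∀ t : ℝ, volume (cube n c r) ^ t ≠ 0 := fun t =>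
    (ENNReal.rpow_pos (pos_iff_ne_zero.2 h0) ht).ne'
  have hpowt : ∀ t : ℝ, volume (cube n c r) ^ t ≠ ⊤ := fun t =>
    ENNReal.rpow_ne_top_of_ne_zero h0 ht
  have hmul : volume (cube n c r) ^ m * volume (cube n c r) ^ (1 - m) = volume (cube n c r) := by
    rw [← ENNReal.rpow_add _ _ h0 ht]; simp
  have hU1 : vnorm p ((cube n c r).indicator 1) ≤ (B + 1) * volume (cube n c r) ^ m := by
    have hJ := jensen (cube n c r) h0 ht (fun x => -(1 / p x)) (by fun_prop)
      (fun x => by rw [abs_neg, abs_of_nonneg (hb0 x)]; exact hb1 x)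
    have hneg : ⨍ x in cube n c r, -(1 / p x) = -m := by
      rw [hm, setAverage_eq, setAverage_eq, integral_neg, smul_neg]
    rw [hneg] at hJ
    have := vnorm_upper hp hB hbdd
      ((cube n c r).indicator fun x => volume (cube n c r) ^ (-(1 / p x))) ?_ c r hr
      (volume (cube n c r) ^ (-m)) (hpow0 _) (hpowt _) ?_
    · rwa [ENNReal.rpow_neg, div_eq_mul_inv, inv_inv] at this
    · calc _ = ∫⁻ x in cube n c r, (volume (cube n c r))⁻¹ := by
            rw [← lintegral_indicator hQ]
            refine lintegral_congr fun x => ?_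
            have := hp x
            by_cases hx : x ∈ cube n c r
            · simp only [Set.indicator_of_mem hx]
              rw [← ENNReal.rpow_mul, neg_mul, one_div_mul_cancel (by linarith),
                ENNReal.rpow_neg_one]
            · simp only [Set.indicator_of_notMem hx]
              exact ENNReal.zero_rpow_of_pos (by linarith)
        _ ≤ 1 := by simp [ENNReal.inv_mul_cancel h0 ht]
    · unfold eavg
      rw [ENNReal.le_div_iff_mul_le (Or.inl h0) (Or.inl ht), setLIntegral_indicator hQ,
        Set.inter_self, mul_comm]
      exact hJ
  have hU2 : vnorm (fun x => p x / (p x - 1)) ((cube n c r).indicator 1) ≤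
      4 * (B + 1) * volume (cube n c r) ^ (1 - m) := by
    have hKt : 4 * (B + 1) * volume (cube n c r) ^ (1 - m) ≠ ⊤ :=
      ENNReal.mul_ne_top (by finiteness) (hpowt _)
    have hK0 : 4 * (B + 1) * volume (cube n c r) ^ (1 - m) ≠ 0 :=
      mul_ne_zero (by simp) (hpow0 _)
    apply sInf_le
    refine ⟨pos_iff_ne_zero.2 hK0, ?_⟩
    by_contra hcon
    have h1 := dual_upper hp hpm hp1 hB hbdd c r hr hQ h0 ht _ hK0 hKt (not_le.1 hcon)
    have h2 := hL1.trans h1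
    rw [ENNReal.le_div_iff_mul_le (Or.inl (ENNReal.div_pos hK0 ht).ne')
      (Or.inl (ENNReal.div_ne_top hKt h0))] at h2
    have e : 2⁻¹ * volume (cube n c r) ^ m *
        (4 * (B + 1) * volume (cube n c r) ^ (1 - m) / volume (cube n c r)) = 2 * (B + 1) := by
      calc _ = (2⁻¹ * 4) * (B + 1) * ((volume (cube n c r) ^ m * volume (cube n c r) ^ (1 - m)) *
            (volume (cube n c r))⁻¹) := by rw [div_eq_mul_inv]; ring
        _ = _ := by
          rw [hmul, ENNReal.mul_inv_cancel h0 ht, mul_one,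
            show (4 : ℝ≥0∞) = 2 * 2 by norm_num, ← mul_assoc,
            ENNReal.inv_mul_cancel (by simp) (by simp), one_mul]
    rw [e] at h2
    have h3 : B + 1 < 2 * (B + 1) := by
      rw [two_mul]
      exact ENNReal.lt_add_right (by finiteness) (by simp)
    exact absurd h3 (not_lt.2 h2)
  refine ⟨⟨hL1, hU1⟩, ⟨hL2, hU2⟩, ?_⟩
  calc _ ≤ ((B + 1) * volume (cube n c r) ^ m) *
        (4 * (B + 1) * volume (cube n c r) ^ (1 - m)) := by gcongr
    _ = (B + 1) * (4 * (B + 1)) * (volume (cube n c r) ^ m * volume (cube n c r) ^ (1 - m)) := by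
        ring
    _ = _ := by rw [hmul]
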